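/- arXiv:1807.08002 — 2 statements merged into one kernel-verified Lean document; each statement's English description precedes it below -/
import Mathlib

section
/- Let f ∈ C²(B(Q,R)) be harmonic on B(Q,R) with H(r) = ∫_{∂B(Q,r)} f² dσ > 0 for all 0 < r < R. Then Almgren's frequency N(r) = r ∫_{B(Q,r)} |∇f|² dx / ∫_{∂B(Q,r)} f² dσ is monotone nondecreasing on (0,R). -/
open MeasureTheory Metric Filter Set
open scoped ENNReal NNReal Topology RealInnerProductSpace

noncomputable section

abbrev E (n : ℕ) := EuclideanSpace ℝ (Fin n)

/-- The Laplacian of `f : ℝⁿ → ℝ`, as the sum of second partial derivatives. -/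
def lap (n : ℕ) (f : E n → ℝ) (x : E n) : ℝ :=
  ∑ i : Fin n, fderiv ℝ (fun y => fderiv ℝ f y (EuclideanSpace.single i 1)) x
    (EuclideanSpace.single i 1)

/-- The Weiss-type functional
`W_d(r,Q,f) = r^{-(n-2+2d)} ∫_{B(Q,r)} |∇f|² - d r^{-(n-1+2d)} ∫_{∂B(Q,r)} f² dσ`,
with surface measure given by the `(n-1)`-dimensional Hausdorff measure. -/
def weiss (n : ℕ) (d r : ℝ) (Q : E n) (f : E n → ℝ) : ℝ :=
  (1 / r ^ ((n : ℝ) - 2 + 2 * d)) * (∫ x in ball Q r, ‖gradient f x‖ ^ 2)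
    - (d / r ^ ((n : ℝ) - 1 + 2 * d)) * ∫ x in sphere Q r, (f x) ^ 2 ∂μH[(n : ℝ) - 1]

/-! ### Parametric integrals over the unit sphere -/

abbrev US (n : ℕ) := sphere (0 : E n) 1

abbrev sg (n : ℕ) : Measure (US n) := (volume : Measure (E n)).toSphere

theorem us_cont_int {n : ℕ} {g : US n → ℝ} (hg : Continuous g) : Integrable g (sg n) :=
  hg.integrable_of_hasCompactSupport (HasCompactSupport.of_compactSpace g)

theorem param_bound {n : ℕ} {a b t : ℝ} (ht : t ∈ Ioo a b) (F : ℝ → US n → ℝ)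
    (hF : ContinuousOn (Function.uncurry F) (Ioo a b ×ˢ univ)) :
    ∃ s ∈ 𝓝 t, s ⊆ Ioo a b ∧ ∃ C, ∀ x ∈ s, ∀ w, ‖F x w‖ ≤ C := by
  obtain ⟨a', ha', hat⟩ := exists_between ht.1
  obtain ⟨b', hb', hbt⟩ := exists_between ht.2
  have hsub : Icc a' b' ⊆ Ioo a b := fun x hx => ⟨by linarith [hx.1], by linarith [hx.2]⟩
  obtain ⟨C, hC⟩ := ((isCompact_Icc (a := a') (b := b')).prod
    (isCompact_univ (X := US n))).exists_bound_of_continuousOn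
    (hF.mono (prod_mono hsub Subset.rfl))
  exact ⟨Icc a' b', Icc_mem_nhds hat hb', hsub, C, fun x hx w => hC (x, w) ⟨hx, mem_univ _⟩⟩

theorem slice_cont {n : ℕ} {a b t : ℝ} (ht : t ∈ Ioo a b) (F : ℝ → US n → ℝ)
    (hF : ContinuousOn (Function.uncurry F) (Ioo a b ×ˢ univ)) : Continuous (F t) := by
  rw [← continuousOn_univ]
  exact hF.comp (f := fun w => (t, w)) (by fun_prop) (fun w _ => ⟨ht, mem_univ _⟩)

theorem param_deriv {n : ℕ} {a b : ℝ} (F F' : ℝ → US n → ℝ)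
    (hd : ∀ t ∈ Ioo a b, ∀ w, HasDerivAt (fun x => F x w) (F' t w) t)
    (hc : ∀ t ∈ Ioo a b, Continuous (F t))
    (hF : ContinuousOn (Function.uncurry F') (Ioo a b ×ˢ univ)) {t : ℝ} (ht : t ∈ Ioo a b) :
    HasDerivAt (fun x => ∫ w, F x w ∂(sg n)) (∫ w, F' t w ∂(sg n)) t := by
  obtain ⟨s, hs, hsub, C, hC⟩ := param_bound ht F' hF
  refine (hasDerivAt_integral_of_dominated_loc_of_deriv_le (bound := fun _ => C) hs ?_
    (us_cont_int (hc t ht)) (slice_cont ht F' hF).aestronglyMeasurable ?_ (integrable_const _)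
    ?_).2
  · filter_upwards [hs] with x hx using (hc x (hsub hx)).aestronglyMeasurable
  · exact .of_forall fun w x hx => hC x hx w
  · exact .of_forall fun w x hx => hd x (hsub hx) w

theorem param_cont {n : ℕ} {a b : ℝ} (F : ℝ → US n → ℝ)
    (hF : ContinuousOn (Function.uncurry F) (Ioo a b ×ˢ univ)) :
    ContinuousOn (fun x => ∫ w, F x w ∂(sg n)) (Ioo a b) := by
  intro t ht
  apply ContinuousAt.continuousWithinAt
  obtain ⟨s, hs, hsub, C, hC⟩ := param_bound ht F hF
  refine continuousAt_of_dominated (bound := fun _ => C) ?_ ?_ (integrable_const _) ?_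
  · filter_upwards [hs] with x hx using (slice_cont (hsub hx) F hF).aestronglyMeasurable
  · filter_upwards [hs] with x hx using .of_forall (hC x hx)
  · refine .of_forall fun w => ?_
    have h1 : ContinuousOn (fun x => F x w) (Ioo a b) :=
      hF.comp (f := fun x => (x, w)) (by fun_prop) (fun x hx => ⟨hx, mem_univ _⟩)
    exact h1.continuousAt (isOpen_Ioo.mem_nhds ht)

theorem smul_mem_ball {n : ℕ} {R s : ℝ} (hs : s ∈ Ioo (-R) R) (w : US n) :
    s • (w : E n) ∈ ball (0 : E n) R := by
  have : ‖(w : E n)‖ = 1 := by simp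
  rw [mem_ball_zero_iff, norm_smul, this, mul_one, Real.norm_eq_abs, abs_lt]
  exact hs

theorem comp_smul_cont {n : ℕ} {R : ℝ} {Y : Type*} [TopologicalSpace Y] {g : E n → Y}
    (hg : ContinuousOn g (ball 0 R)) :
    ContinuousOn (fun p : ℝ × US n => g (p.1 • (p.2 : E n))) (Ioo (-R) R ×ˢ univ) :=
  hg.comp (by fun_prop) (fun p hp => smul_mem_ball hp.1 p.2)

/-! ### Rotation invariance -/

open scoped Pointwise in
theorem toSphere_rot {n : ℕ} (U : E n ≃ₗᵢ[ℝ] E n) :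
    ∃ V : US n ≃ᵐ US n, (∀ w, (V w : E n) = U w) ∧ MeasurePreserving V (sg n) (sg n) := by
  let h : US n ≃ₜ US n :=
    { toFun := fun w => ⟨U w, by simp⟩
      invFun := fun w => ⟨U.symm w, by simp⟩
      left_inv := fun w => by simp
      right_inv := fun w => by simp
      continuous_toFun := by fun_prop
      continuous_invFun := by fun_prop }
  refine ⟨h.toMeasurableEquiv, fun w => rfl, h.measurable, ?_⟩
  ext s hs
  have hm : MeasurableSet (h ⁻¹' s) := h.measurable hs
  have := Measure.map_apply (μ := sg n) h.measurable hs
  refine this.trans ?_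
  rw [Measure.toSphere_apply' _ hm, Measure.toSphere_apply' _ hs]
  congr 1
  rw [← U.measurePreserving.measure_preimage_emb U.toHomeomorph.measurableEmbedding
    (Ioo (0 : ℝ) 1 • ((fun a : US n => (a : E n)) '' s))]
  congr 1
  ext x
  simp only [Set.mem_smul, mem_image, mem_preimage]
  constructor
  · rintro ⟨c, hc, _, ⟨w, hw, rfl⟩, rfl⟩
    exact ⟨c, hc, _, ⟨h w, hw, rfl⟩, by simp [h]⟩
  · rintro ⟨c, hc, _, ⟨w, hw, rfl⟩, hx⟩
    refine ⟨c, hc, _, ⟨h.symm w, by simpa using hw, rfl⟩, ?_⟩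
    have : U.symm (c • (w : E n)) = x := by rw [hx]; simp
    rw [← this, map_smul]; rfl

theorem rot_int {n : ℕ} (U : E n ≃ₗᵢ[ℝ] E n) (g : E n → ℝ) :
    ∫ w : US n, g (U w) ∂(sg n) = ∫ w : US n, g w ∂(sg n) := by
  obtain ⟨V, hV, hm⟩ := toSphere_rot U
  rw [← hm.integral_comp' (fun w : US n => g w)]
  simp [hV]

/-- the rotation vector field -/
def rv {n : ℕ} (i j : Fin n) (x : E n) : E n :=
  x i • EuclideanSpace.single j (1 : ℝ) - x j • EuclideanSpace.single i (1 : ℝ)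

def rotFun {n : ℕ} (i j : Fin n) (t : ℝ) (x : E n) : E n :=
  x + ((Real.cos t - 1) * x i - Real.sin t * x j) • EuclideanSpace.single i (1 : ℝ)
    + ((Real.cos t - 1) * x j + Real.sin t * x i) • EuclideanSpace.single j (1 : ℝ)

theorem norm_rotFun {n : ℕ} {i j : Fin n} (hij : i ≠ j) (t : ℝ) (x : E n) :
    ‖rotFun i j t x‖ = ‖x‖ := by
  rw [← sq_eq_sq₀ (norm_nonneg _) (norm_nonneg _)]
  unfold rotFun
  rw [norm_add_sq_real, norm_add_sq_real]
  simp only [inner_add_left, inner_smul_left, inner_smul_right, norm_smul,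
    EuclideanSpace.inner_single_right]
  simp [hij.symm]
  have := Real.sin_sq_add_cos_sq t
  linear_combination (x i ^ 2 + x j ^ 2) * this

def rot {n : ℕ} {i j : Fin n} (hij : i ≠ j) (t : ℝ) : E n ≃ₗᵢ[ℝ] E n :=
  LinearIsometry.toLinearIsometryEquiv
    { toFun := rotFun i j t
      map_add' := fun x y => by
        unfold rotFun; simp only [PiLp.add_apply]; module
      map_smul' := fun c y => by
        unfold rotFun; simp only [PiLp.smul_apply, smul_eq_mul, RingHom.id_apply]; module
      norm_map' := norm_rotFun hij t } rfl

theorem rot_apply {n : ℕ} {i j : Fin n} (hij : i ≠ j) (t : ℝ) (x : E n) :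
    rot hij t x = rotFun i j t x := rfl

theorem hasDerivAt_rotFun {n : ℕ} (i j : Fin n) (t : ℝ) (x : E n) :
    HasDerivAt (fun t => rotFun i j t x)
     ((- Real.sin t * x i - Real.cos t * x j) • EuclideanSpace.single i (1 : ℝ)
    + (- Real.sin t * x j + Real.cos t * x i) • EuclideanSpace.single j (1 : ℝ)) t := by
  unfold rotFun
  have h1 := ((((Real.hasDerivAt_cos t).sub_const 1).mul_const (x i)).sub
    ((Real.hasDerivAt_sin t).mul_const (x j))).smul_const (EuclideanSpace.single i (1 : ℝ))
  have h2 := ((((Real.hasDerivAt_cos t).sub_const 1).mul_const (x j)).add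
    ((Real.hasDerivAt_sin t).mul_const (x i))).smul_const (EuclideanSpace.single j (1 : ℝ))
  exact (h1.const_add x).add h2

theorem rot_deriv_zero {n : ℕ} {R s : ℝ} (hs : s ∈ Ioo (-R) R) {g : E n → ℝ}
    (hg : ContDiffOn ℝ 1 g (ball 0 R)) (i j : Fin n) :
    ∫ w : US n, fderiv ℝ g (s • (w : E n)) (rv i j (s • (w : E n))) ∂(sg n) = 0 := by
  by_cases hij : i = j
  · subst hij
    simp [rv]
  have hmem : ∀ (t : ℝ) (w : US n), rotFun i j t (s • (w : E n)) ∈ ball (0 : E n) R := by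
    intro t w
    rw [mem_ball_zero_iff, norm_rotFun hij, ← mem_ball_zero_iff]
    exact smul_mem_ball hs w
  have hcr : Continuous (fun p : ℝ × US n => rotFun i j p.1 (s • (p.2 : E n))) := by
    unfold rotFun; simp only [PiLp.smul_apply]; fun_prop
  have hgd : ∀ x ∈ ball (0 : E n) R, HasFDerivAt g (fderiv ℝ g x) x := fun x hx =>
    ((hg.differentiableOn one_ne_zero).differentiableAt (isOpen_ball.mem_nhds hx)).hasFDerivAt
  have hgc : ContinuousOn (fderiv ℝ g) (ball 0 R) :=
    hg.continuousOn_fderiv_of_isOpen isOpen_ball le_rfl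
  have key := param_deriv (n := n) (a := -1) (b := 1) (t := 0)
    (fun t w => g (rotFun i j t (s • (w : E n))))
    (fun t w => fderiv ℝ g (rotFun i j t (s • (w : E n)))
      ((- Real.sin t * (s • (w : E n)) i - Real.cos t * (s • (w : E n)) j) •
        EuclideanSpace.single i (1 : ℝ)
      + (- Real.sin t * (s • (w : E n)) j + Real.cos t * (s • (w : E n)) i) •
        EuclideanSpace.single j (1 : ℝ)))
    (fun t _ w => (hgd _ (hmem t w)).comp_hasDerivAt t (hasDerivAt_rotFun i j t _))
    (fun t _ => by
      rw [← continuousOn_univ]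
      exact hg.continuousOn.comp (hcr.comp (by fun_prop : Continuous fun w => (t, w))).continuousOn
        (fun w _ => hmem t w))
    (by
      apply ContinuousOn.clm_apply
      · exact hgc.comp hcr.continuousOn (fun p _ => hmem p.1 p.2)
      · simp only [PiLp.smul_apply]
        fun_prop) (by simp)
  have hconst : (fun t => ∫ w : US n, g (rotFun i j t (s • (w : E n))) ∂(sg n)) =
      fun _ => ∫ w : US n, g (s • (w : E n)) ∂(sg n) := by
    funext t
    have := rot_int (rot hij t) (fun x => g (s • x))
    rw [← this]
    congr 1
    funext w
    rw [← rot_apply hij, map_smul]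
  rw [hconst] at key
  have := key.unique (hasDerivAt_const _ _)
  rw [← this]
  congr 1
  funext w
  simp [rotFun, rv]
  ring

/-! ### The divergence theorem on balls -/

theorem clm_expand {n : ℕ} (L : E n →L[ℝ] ℝ) (x : E n) :
    L x = ∑ i, x i * L (EuclideanSpace.single i 1) := by
  have hx : x = ∑ i, x i • EuclideanSpace.single i (1 : ℝ) := by
    ext k
    simp [Finset.sum_apply, Pi.single_apply]
  conv_lhs => rw [hx]
  simp

def dv {n : ℕ} (X : Fin n → E n → ℝ) (x : E n) : ℝ :=
  ∑ j, fderiv ℝ (X j) x (EuclideanSpace.single j 1)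

theorem c1_fderiv_cont {n : ℕ} {R : ℝ} {g : E n → ℝ} (hg : ContDiffOn ℝ 1 g (ball 0 R)) :
    ContinuousOn (fderiv ℝ g) (ball 0 R) :=
  hg.continuousOn_fderiv_of_isOpen isOpen_ball le_rfl

theorem c1_diff {n : ℕ} {R : ℝ} {g : E n → ℝ} (hg : ContDiffOn ℝ 1 g (ball 0 R)) {x : E n}
    (hx : x ∈ ball (0 : E n) R) : HasFDerivAt g (fderiv ℝ g x) x :=
  ((hg.differentiableOn one_ne_zero).differentiableAt (isOpen_ball.mem_nhds hx)).hasFDerivAt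

theorem dv_cont {n : ℕ} {R : ℝ} {X : Fin n → E n → ℝ}
    (hX : ∀ j, ContDiffOn ℝ 1 (X j) (ball 0 R)) : ContinuousOn (dv X) (ball 0 R) := by
  unfold dv
  exact continuousOn_finsetSum _ fun j _ => (c1_fderiv_cont (hX j)).clm_apply continuousOn_const

theorem coord_cont {n : ℕ} (i : Fin n) : Continuous (fun y : E n => y i) := by fun_prop

theorem coord_contDiff {n : ℕ} (i : Fin n) : ContDiff ℝ 1 (fun y : E n => y i) := by fun_prop

theorem pointwise_id {n : ℕ} {R : ℝ} {X : Fin n → E n → ℝ}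
    (hX : ∀ j, ContDiffOn ℝ 1 (X j) (ball 0 R)) {x : E n} (hx : x ∈ ball (0 : E n) R) :
    ∑ i, ∑ j, fderiv ℝ (fun y => y i * X j y) x (rv i j x) =
      ‖x‖ ^ 2 * dv X x - ∑ j, x j * fderiv ℝ (X j) x x - ((n : ℝ) - 1) * ∑ j, x j * X j x := by
  have h1 : ∀ i j, fderiv ℝ (fun y => y i * X j y) x (rv i j x) =
      x i ^ 2 * fderiv ℝ (X j) x (EuclideanSpace.single j 1)
      - x j * (x i * fderiv ℝ (X j) x (EuclideanSpace.single i 1))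
      + (if i = j then x i * X j x else 0) - x j * X j x := by
    intro i j
    have hc : HasFDerivAt (fun y : E n => y i) (EuclideanSpace.proj i : E n →L[ℝ] ℝ) x :=
      (EuclideanSpace.proj i : E n →L[ℝ] ℝ).hasFDerivAt
    have := (hc.mul (c1_diff (hX j) hx)).fderiv
    have h2 : (fun y : E n => y i * X j y) = (fun y : E n => y i) * X j := rfl
    rw [h2, this]
    simp only [rv, add_apply, smul_apply, map_sub, map_smul, smul_eq_mul]
    by_cases hij : i = j
    · subst hij; simp; ring
    · simp [hij]; ring
  simp only [h1, Finset.sum_add_distrib, Finset.sum_sub_distrib, Finset.sum_ite_eq,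
    Finset.mem_univ, if_true]
  have h3 : ∀ j, fderiv ℝ (X j) x x =
      ∑ i, x i * fderiv ℝ (X j) x (EuclideanSpace.single i 1) := fun j => clm_expand _ _
  have h4 : ∑ i, ∑ j, x i ^ 2 * fderiv ℝ (X j) x (EuclideanSpace.single j 1)
      = ‖x‖ ^ 2 * dv X x := by
    rw [EuclideanSpace.real_norm_sq_eq, dv, Finset.sum_mul_sum]
  have h5 : ∑ i, ∑ j, x j * (x i * fderiv ℝ (X j) x (EuclideanSpace.single i 1))
      = ∑ j, x j * fderiv ℝ (X j) x x := by
    rw [Finset.sum_comm]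
    exact Finset.sum_congr rfl fun j _ => by rw [h3, Finset.mul_sum]
  rw [h4, h5]
  simp
  ring

theorem sphere_int {n : ℕ} {R s : ℝ} (hs : s ∈ Ioo (-R) R) {g : E n → ℝ}
    (hg : ContinuousOn g (ball 0 R)) : Integrable (fun w : US n => g (s • (w : E n))) (sg n) := by
  apply us_cont_int
  exact slice_cont hs (fun t (w : US n) => g (t • (w : E n))) (comp_smul_cont hg)

theorem tang_div {n : ℕ} {R s : ℝ} (hs : s ∈ Ioo (-R) R) {X : Fin n → E n → ℝ}
    (hX : ∀ j, ContDiffOn ℝ 1 (X j) (ball 0 R)) :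
    s ^ 2 * ∫ w : US n, dv X (s • (w : E n)) ∂(sg n) =
      s ^ 2 * (∫ w : US n, ∑ j, (w : E n) j * fderiv ℝ (X j) (s • (w : E n)) w ∂(sg n))
      + s * (((n : ℝ) - 1) * ∫ w : US n, ∑ j, (w : E n) j * X j (s • (w : E n)) ∂(sg n)) := by
  have hc : ∀ i j, ContDiffOn ℝ 1 (fun y : E n => y i * X j y) (ball 0 R) := fun i j =>
    (coord_contDiff i).contDiffOn.mul (hX j)
  have hrv : ∀ i j : Fin n, Continuous (rv i j) := by
    intro i j; unfold rv; fun_prop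
  have h0 : ∫ w : US n, (fun x => ∑ i, ∑ j, fderiv ℝ (fun y => y i * X j y) x (rv i j x))
      (s • (w : E n)) ∂(sg n) = 0 := by
    have hI : ∀ i j, Integrable (fun w : US n => (fun x => fderiv ℝ (fun y => y i * X j y) x
        (rv i j x)) (s • (w : E n))) (sg n) := fun i j =>
      sphere_int hs ((c1_fderiv_cont (hc i j)).clm_apply (hrv i j).continuousOn)
    simp only
    rw [integral_finsetSum _ fun i _ => integrable_finsetSum _ fun j _ => hI i j]
    refine Finset.sum_eq_zero fun i _ => ?_
    rw [integral_finsetSum _ fun j _ => hI i j]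
    exact Finset.sum_eq_zero fun j _ => rot_deriv_zero hs (hc i j) i j
  have h1 : ∀ w : US n, (fun x => ∑ i, ∑ j, fderiv ℝ (fun y => y i * X j y) x (rv i j x))
      (s • (w : E n)) = s ^ 2 * dv X (s • (w : E n))
      - s ^ 2 * (∑ j, (w : E n) j * fderiv ℝ (X j) (s • (w : E n)) w)
      - s * (((n : ℝ) - 1) * ∑ j, (w : E n) j * X j (s • (w : E n))) := by
    intro w
    simp only
    rw [pointwise_id hX (smul_mem_ball hs w)]
    have hw : ‖(w : E n)‖ = 1 := by simp
    simp only [norm_smul, hw, map_smul, PiLp.smul_apply, smul_eq_mul, Finset.mul_sum]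
    simp only [Real.norm_eq_abs, mul_one, sq_abs]
    congr 1
    · congr 1
      exact Finset.sum_congr rfl fun j _ => by ring
    · exact Finset.sum_congr rfl fun j _ => by ring
  simp only [h1] at h0
  have i1 : Integrable (fun w : US n => dv X (s • (w : E n))) (sg n) := sphere_int hs (dv_cont hX)
  have i2 : Integrable (fun w : US n => ∑ j, (w : E n) j * fderiv ℝ (X j) (s • (w : E n)) w)
      (sg n) := by
    apply us_cont_int
    refine continuous_finsetSum _ fun j _ => ?_
    have := slice_cont hs (fun t (w : US n) => (fderiv ℝ (X j) (t • (w : E n))) w)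
      ((comp_smul_cont (c1_fderiv_cont (hX j))).clm_apply (by fun_prop))
    exact Continuous.mul (by fun_prop) this
  have i3 : Integrable (fun w : US n => ∑ j, (w : E n) j * X j (s • (w : E n))) (sg n) := by
    apply us_cont_int
    refine continuous_finsetSum _ fun j _ => ?_
    have := slice_cont hs (fun t (w : US n) => (X j) (t • (w : E n)))
      (comp_smul_cont (hX j).continuousOn)
    exact Continuous.mul (by fun_prop) this
  rw [integral_sub (Integrable.sub' (i1.const_mul _) (i2.const_mul _)) ((i3.const_mul _).const_mul _),
    integral_sub (i1.const_mul _) (i2.const_mul _)] at h0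
  simp only [integral_const_mul] at h0
  linarith

theorem radial_deriv {n : ℕ} {R s : ℝ} (hs : s ∈ Ioo (-R) R) {X : Fin n → E n → ℝ}
    (hX : ∀ j, ContDiffOn ℝ 1 (X j) (ball 0 R)) :
    HasDerivAt (fun s : ℝ => ∫ w : US n, ∑ j, (w : E n) j * X j (s • (w : E n)) ∂(sg n))
      (∫ w : US n, ∑ j, (w : E n) j * fderiv ℝ (X j) (s • (w : E n)) w ∂(sg n)) s := by
  refine param_deriv (n := n) (a := -R) (b := R)
    (fun s w => ∑ j, (w : E n) j * X j (s • (w : E n)))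
    (fun s w => ∑ j, (w : E n) j * fderiv ℝ (X j) (s • (w : E n)) w) ?_ ?_ ?_ hs
  · intro t ht w
    refine HasDerivAt.fun_sum fun j _ => ?_
    refine HasDerivAt.const_mul _ ?_
    have h1 : HasDerivAt (fun x : ℝ => x • (w : E n)) (w : E n) t := by
      simpa using (hasDerivAt_id t).smul_const (w : E n)
    exact (c1_diff (hX j) (smul_mem_ball ht w)).comp_hasDerivAt t h1
  · intro t ht
    refine continuous_finsetSum _ fun j _ => ?_
    have := slice_cont ht (fun t (w : US n) => (X j) (t • (w : E n)))
      (comp_smul_cont (hX j).continuousOn)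
    exact Continuous.mul (by fun_prop) this
  · refine continuousOn_finsetSum _ fun j _ => ?_
    refine ContinuousOn.mul (by fun_prop) ?_
    exact (comp_smul_cont (c1_fderiv_cont (hX j))).clm_apply (by fun_prop)

theorem radial_deriv_fun {n : ℕ} {R s : ℝ} (hs : s ∈ Ioo (-R) R) {g : E n → ℝ}
    (hg : ContDiffOn ℝ 1 g (ball 0 R)) :
    HasDerivAt (fun s : ℝ => ∫ w : US n, g (s • (w : E n)) ∂(sg n))
      (∫ w : US n, fderiv ℝ g (s • (w : E n)) w ∂(sg n)) s := by
  refine param_deriv (n := n) (a := -R) (b := R)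
    (fun s w => g (s • (w : E n))) (fun s w => fderiv ℝ g (s • (w : E n)) w) ?_ ?_ ?_ hs
  · intro t ht w
    have h1 : HasDerivAt (fun x : ℝ => x • (w : E n)) (w : E n) t := by
      simpa using (hasDerivAt_id t).smul_const (w : E n)
    exact (c1_diff hg (smul_mem_ball ht w)).comp_hasDerivAt t h1
  · intro t ht
    exact slice_cont ht (fun t (w : US n) => g (t • (w : E n))) (comp_smul_cont hg.continuousOn)
  · exact (comp_smul_cont (c1_fderiv_cont hg)).clm_apply (by fun_prop)

theorem div_thm {n : ℕ} (hn : 2 ≤ n) {R r : ℝ} (hr : r ∈ Ioo 0 R) {X : Fin n → E n → ℝ}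
    (hX : ∀ j, ContDiffOn ℝ 1 (X j) (ball 0 R)) :
    ∫ s in (0 : ℝ)..r, s ^ (n - 1) * ∫ w : US n, dv X (s • (w : E n)) ∂(sg n) =
      r ^ (n - 1) * ∫ w : US n, ∑ j, (w : E n) j * X j (r • (w : E n)) ∂(sg n) := by
  have hsub : Icc 0 r ⊆ Ioo (-R) R := fun x hx =>
    ⟨by linarith [hx.1, hr.1, hr.2], by linarith [hx.2, hr.2]⟩
  set A := fun s : ℝ => ∫ w : US n, ∑ j, (w : E n) j * X j (s • (w : E n)) ∂(sg n) with hA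
  have hAc : ContinuousOn (fun s : ℝ => s ^ (n - 1) * A s) (Icc 0 r) := by
    refine ContinuousOn.mul (by fun_prop) ?_
    exact fun s hs => (radial_deriv (hsub hs) hX).continuousAt.continuousWithinAt
  rw [intervalIntegral.integral_eq_sub_of_hasDerivAt_of_le hr.1.le hAc]
  · have : n - 1 ≠ 0 := by omega
    simp [this, hA]
  · intro s hs
    have hs' := hsub (Ioo_subset_Icc_self hs)
    have hd := (hasDerivAt_pow (n - 1) s).mul (radial_deriv hs' hX)
    have ht := tang_div hs' hX
    have hs0 : s ≠ 0 := hs.1.ne'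
    refine hd.congr_deriv ?_
    obtain ⟨m, rfl⟩ : ∃ m, n = m + 2 := ⟨n - 2, by omega⟩
    have e1 : m + 2 - 1 = m + 1 := by omega
    rw [e1]
    have e2 : m + 1 - 1 = m := by omega
    rw [e2]
    apply mul_left_cancel₀ (pow_ne_zero 2 hs0)
    push_cast at ht ⊢
    linear_combination - s ^ (m + 1) * ht
  · apply ContinuousOn.intervalIntegrable
    rw [uIcc_of_le hr.1.le]
    refine ContinuousOn.mul (by fun_prop) ?_
    exact (param_cont (fun s (w : US n) => dv X (s • (w : E n)))
      (comp_smul_cont (dv_cont hX))).mono hsub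

/-! ### Polar coordinates -/

theorem polar {n : ℕ} (hn : 2 ≤ n) {R r : ℝ} (hr : r ∈ Ioo 0 R) {g : E n → ℝ}
    (hg : ContinuousOn g (ball 0 R)) :
    ∫ x in ball (0 : E n) r, g x =
      ∫ s in (0 : ℝ)..r, s ^ (n - 1) * ∫ w : US n, g (s • (w : E n)) ∂(sg n) := by
  have : Nontrivial (E n) := by
    have : Nonempty (Fin n) := ⟨⟨0, by omega⟩⟩
    infer_instance
  set G : E n → ℝ := (ball (0 : E n) r).indicator g with hG
  have hGi : Integrable G := by
    rw [hG, integrable_indicator_iff measurableSet_ball]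
    have : IntegrableOn g (closedBall 0 r) :=
      (hg.mono (closedBall_subset_ball hr.2)).integrableOn_compact (isCompact_closedBall _ _)
    exact this.mono_set ball_subset_closedBall
  have hdim : Module.finrank ℝ (E n) = n := by simp
  have mp := (volume : Measure (E n)).measurePreserving_homeomorphUnitSphereProd
  have hme := (homeomorphUnitSphereProd (E n)).measurableEmbedding
  have hpt : ∀ x : ({0}ᶜ : Set (E n)), G (((homeomorphUnitSphereProd (E n) x).2 : ℝ) •
      ((homeomorphUnitSphereProd (E n) x).1 : E n)) = G x := by
    intro x
    have := congrArg Subtype.val ((homeomorphUnitSphereProd (E n)).symm_apply_apply x)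
    rw [homeomorphUnitSphereProd_symm_apply_coe] at this
    rw [this]
  have hi : Integrable (fun x : ({0}ᶜ : Set (E n)) => G x) ((volume : Measure (E n)).comap (↑)) := by
    have := (integrableOn_iff_comap_subtypeVal (μ := (volume : Measure (E n)))
      (measurableSet_singleton (0 : E n)).compl).1 hGi.integrableOn
    exact this
  have hprod : Integrable (fun p : US n × Ioi (0 : ℝ) => G ((p.2 : ℝ) • (p.1 : E n)))
      ((sg n).prod (Measure.volumeIoiPow (Module.finrank ℝ (E n) - 1))) := by
    rw [← mp.integrable_comp_emb hme]
    refine hi.congr (.of_forall fun x => ?_)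
    exact (hpt x).symm
  calc ∫ x in ball (0 : E n) r, g x = ∫ x, G x := (integral_indicator measurableSet_ball).symm
    _ = ∫ x : ({0}ᶜ : Set (E n)), G x ∂((volume : Measure (E n)).comap (↑)) := by
      rw [integral_subtype_comap (measurableSet_singleton _).compl fun x ↦ G x,
        restrict_compl_singleton]
    _ = ∫ p, G ((p.2 : ℝ) • (p.1 : E n)) ∂((sg n).prod
          (Measure.volumeIoiPow (Module.finrank ℝ (E n) - 1))) := by
      rw [← mp.integral_comp hme]
      exact integral_congr_ae (.of_forall fun x => (hpt x).symm)
    _ = ∫ s : Ioi (0 : ℝ), (∫ w : US n, G ((s : ℝ) • (w : E n)) ∂(sg n))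
          ∂(Measure.volumeIoiPow (n - 1)) := by
      rw [integral_prod_symm _ hprod, hdim]
    _ = ∫ s in Ioi (0 : ℝ), s ^ (n - 1) * (∫ w : US n, G (s • (w : E n)) ∂(sg n)) := by
      simp only [Measure.volumeIoiPow, ENNReal.ofReal]
      rw [integral_withDensity_eq_integral_smul,
        integral_subtype_comap measurableSet_Ioi fun a ↦ Real.toNNReal (a ^ (n - 1)) •
          (∫ w : US n, G (a • (w : E n)) ∂(sg n)),
        setIntegral_congr_fun measurableSet_Ioi fun x hx ↦ ?_]
      · rw [NNReal.smul_def, Real.coe_toNNReal _ (pow_nonneg (mem_Ioi.1 hx).le _), smul_eq_mul]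
      · exact (measurable_subtype_coe.pow_const _).real_toNNReal
    _ = ∫ s in Ioi (0 : ℝ), (Ioo 0 r).indicator
          (fun s => s ^ (n - 1) * ∫ w : US n, g (s • (w : E n)) ∂(sg n)) s := by
      refine setIntegral_congr_fun measurableSet_Ioi fun s hs => ?_
      have hs : 0 < s := hs
      have hnorm : ∀ w : US n, ‖s • (w : E n)‖ = s := fun w => by
        have : ‖(w : E n)‖ = 1 := by simp
        rw [norm_smul, this, mul_one, Real.norm_eq_abs, abs_of_pos hs]
      by_cases hsr : s < r
      · have hmem : s ∈ Ioo 0 r := ⟨hs, hsr⟩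
        rw [indicator_of_mem hmem]
        have : ∀ w : US n, G (s • (w : E n)) = g (s • (w : E n)) := fun w => by
          rw [hG, indicator_of_mem]; rw [mem_ball_zero_iff, hnorm]; exact hsr
        simp only [this]
      · have hmem : s ∉ Ioo 0 r := fun h => hsr h.2
        rw [indicator_of_notMem hmem]
        have : ∀ w : US n, G (s • (w : E n)) = 0 := fun w => by
          rw [hG, indicator_of_notMem]; rw [mem_ball_zero_iff, hnorm]; exact hsr
        simp [this]
    _ = ∫ s in (0 : ℝ)..r, s ^ (n - 1) * ∫ w : US n, g (s • (w : E n)) ∂(sg n) := by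
      rw [setIntegral_indicator measurableSet_Ioo, inter_eq_right.2 (fun x hx => hx.1),
        intervalIntegral.integral_of_le hr.1.le, integral_Ioc_eq_integral_Ioo]

/-! ### Uniqueness of the rotation invariant measure on the sphere -/

theorem unique_aux {n : ℕ} (ρ m : Measure (E n)) [IsFiniteMeasure ρ] [IsFiniteMeasure m]
    (hac : ρ ≪ m) (hsupp : ∀ᵐ x ∂m, x ∈ sphere (0 : E n) 1)
    (hρ : ∀ (U : E n ≃ₗᵢ[ℝ] E n) x r, ρ (closedBall (U x) r) = ρ (closedBall x r))
    (hm : ∀ (U : E n ≃ₗᵢ[ℝ] E n) x r, m (closedBall (U x) r) = m (closedBall x r)) :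
    ∃ c : ℝ≥0∞, ρ = c • m := by
  by_cases hm0 : m = 0
  · subst hm0
    exact ⟨0, by simpa using hac⟩
  have : (ae m).NeBot := ae_neBot.2 hm0
  have hae := Besicovitch.ae_tendsto_rnDeriv ρ m
  obtain ⟨x0, hx0, hx0s⟩ := (hae.and hsupp).exists
  refine ⟨ρ.rnDeriv m x0, ?_⟩
  have hconst : ρ.rnDeriv m =ᵐ[m] fun _ => ρ.rnDeriv m x0 := by
    filter_upwards [hae, hsupp] with x hx hxs
    have hxx : ‖x0‖ = ‖x‖ := by
      rw [mem_sphere_zero_iff_norm] at hxs hx0s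
      rw [hxs, hx0s]
    have hU := Submodule.reflection_sub hxx
    refine tendsto_nhds_unique hx ?_
    refine hx0.congr fun r => ?_
    rw [← hU, hρ, hm]
  have hleb : ρ.HaveLebesgueDecomposition m := Measure.haveLebesgueDecomposition_of_sigmaFinite ρ m
  have h3 := Measure.withDensity_rnDeriv_eq ρ m hac
  rw [withDensity_congr_ae hconst, withDensity_const] at h3
  exact h3.symm

theorem unique_sphere {n : ℕ} (m1 m2 : Measure (E n)) [IsFiniteMeasure m1] [IsFiniteMeasure m2]
    (h1s : ∀ᵐ x ∂m1, x ∈ sphere (0 : E n) 1) (h2s : ∀ᵐ x ∂m2, x ∈ sphere (0 : E n) 1)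
    (h1 : ∀ (U : E n ≃ₗᵢ[ℝ] E n) x r, m1 (closedBall (U x) r) = m1 (closedBall x r))
    (h2 : ∀ (U : E n ≃ₗᵢ[ℝ] E n) x r, m2 (closedBall (U x) r) = m2 (closedBall x r))
    (h0 : m1 ≠ 0) : ∃ c : ℝ≥0∞, m2 = c • m1 := by
  have hs : ∀ᵐ x ∂(m1 + m2), x ∈ sphere (0 : E n) 1 := by
    rw [ae_add_measure_iff]; exact ⟨h1s, h2s⟩
  have hI : ∀ (U : E n ≃ₗᵢ[ℝ] E n) x r,
      (m1 + m2) (closedBall (U x) r) = (m1 + m2) (closedBall x r) := by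
    intro U x r; simp [h1, h2]
  obtain ⟨c1, hc1⟩ := unique_aux m1 (m1 + m2)
    (Measure.absolutelyContinuous_of_le (Measure.le_add_right le_rfl)) hs h1 hI
  obtain ⟨c2, hc2⟩ := unique_aux m2 (m1 + m2)
    (Measure.absolutelyContinuous_of_le (Measure.le_add_left le_rfl)) hs h2 hI
  have hc0 : c1 ≠ 0 := by
    rintro rfl
    exact h0 (by simpa using hc1)
  have hct : c1 ≠ ∞ := by
    rintro rfl
    have := congrArg (fun m => m univ) hc1
    simp only [Measure.smul_apply, smul_eq_mul] at this
    rw [ENNReal.top_mul] at this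
    · exact measure_ne_top _ _ this
    · simp [Measure.measure_univ_eq_zero, h0]
  refine ⟨c2 * c1⁻¹, ?_⟩
  conv_rhs => rw [hc1]
  rw [smul_smul, mul_assoc, ENNReal.inv_mul_cancel hc0 hct, mul_one]
  exact hc2

theorem hausdorff_sphere {n : ℕ} (hn : 2 ≤ n) {g : E n → ℝ} (hg : ContinuousOn g (sphere 0 1))
    (hpos : ∫ w in sphere (0 : E n) 1, g w ∂μH[(n : ℝ) - 1] ≠ 0) :
    ∃ c : ℝ, ∀ h : E n → ℝ, ∫ w in sphere (0 : E n) 1, h w ∂μH[(n : ℝ) - 1] =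
      c * ∫ w : US n, h w ∂(sg n) := by
  have : Nontrivial (E n) := by
    have : Nonempty (Fin n) := ⟨⟨0, by omega⟩⟩
    infer_instance
  have hd : (0 : ℝ) ≤ (n : ℝ) - 1 := by
    have : (2 : ℝ) ≤ n := by exact_mod_cast hn
    linarith
  set m2 : Measure (E n) := (μH[(n : ℝ) - 1] : Measure (E n)).restrict (sphere (0 : E n) 1) with hm2
  set m1 : Measure (E n) := Measure.map (fun w : US n => (w : E n)) (sg n) with hm1
  have hemb : MeasurableEmbedding (fun w : US n => (w : E n)) :=
    MeasurableEmbedding.subtype_coe isClosed_sphere.measurableSet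
  have h2 : ∀ (U : E n ≃ₗᵢ[ℝ] E n) x r, m2 (closedBall (U x) r) = m2 (closedBall x r) := by
    intro U x r
    rw [hm2, Measure.restrict_apply measurableSet_closedBall,
      Measure.restrict_apply measurableSet_closedBall,
      ← U.toIsometryEquiv.hausdorffMeasure_preimage]
    congr 1
    ext y
    simp [dist_eq_norm, ← map_sub]
  have h1 : ∀ (U : E n ≃ₗᵢ[ℝ] E n) x r, m1 (closedBall (U x) r) = m1 (closedBall x r) := by
    intro U x r
    obtain ⟨V, hV, hm⟩ := toSphere_rot U
    rw [hm1, hemb.map_apply, hemb.map_apply, ← hm.measure_preimage_equiv]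
    congr 1
    ext y
    simp [hV, dist_eq_norm, ← map_sub]
  have h1s : ∀ᵐ x ∂m1, x ∈ sphere (0 : E n) 1 := by
    rw [hm1, hemb.ae_map_iff]
    exact .of_forall fun w => w.2
  have h2s : ∀ᵐ x ∂m2, x ∈ sphere (0 : E n) 1 :=
    ae_restrict_mem isClosed_sphere.measurableSet
  have hfin : IsFiniteMeasure m2 := by
    have hgint : Integrable g m2 := by
      by_contra hcon
      exact hpos (integral_undef hcon)
    obtain ⟨w0, hw0, hgw⟩ : ∃ w0 ∈ sphere (0 : E n) 1, g w0 ≠ 0 := by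
      by_contra! hcon
      exact hpos (setIntegral_eq_zero_of_forall_eq_zero hcon)
    have hε : 0 < ‖g w0‖ / 2 := by positivity
    have hnb : ∀ᶠ w in 𝓝[sphere (0 : E n) 1] w0, ‖g w0‖ / 2 < ‖g w‖ :=
      (hg w0 hw0).norm.eventually (lt_mem_nhds (by linarith))
    obtain ⟨δ, hδ, hball⟩ := Metric.mem_nhdsWithin_iff.1 hnb
    have hlt : m2 (closedBall w0 (δ / 2)) < ∞ := by
      have hle := hgint.measure_norm_ge_lt_top hε
      refine lt_of_le_of_lt ?_ hle
      refine measure_mono_ae ?_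
      filter_upwards [h2s] with w hw hwb
      refine (hball ⟨?_, hw⟩ : ‖g w0‖ / 2 < ‖g w‖).le
      have : dist w w0 ≤ δ / 2 := hwb
      rw [mem_ball]; linarith
    have hcpt : m2 (sphere (0 : E n) 1) < ∞ := by
      refine (isCompact_sphere (0 : E n) 1).measure_lt_top_of_nhdsWithin fun x hx => ?_
      have hxx : ‖w0‖ = ‖x‖ := by
        rw [mem_sphere_zero_iff_norm] at hw0 hx
        rw [hw0, hx]
      have hU := Submodule.reflection_sub hxx
      refine ⟨closedBall x (δ / 2), mem_nhdsWithin_of_mem_nhds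
        (closedBall_mem_nhds x (by positivity)), ?_⟩
      rw [← hU, h2]
      exact hlt
    refine ⟨?_⟩
    rw [hm2, Measure.restrict_apply_self] at hcpt
    rwa [hm2, Measure.restrict_apply_univ]
  have h10 : m1 ≠ 0 := by
    rw [hm1, Ne, Measure.map_eq_zero_iff hemb.measurable.aemeasurable]
    exact Measure.toSphere_ne_zero _
  have : IsFiniteMeasure m1 := Measure.isFiniteMeasure_map _ _
  obtain ⟨c, hc⟩ := unique_sphere m1 m2 h1s h2s h1 h2 h10
  refine ⟨c.toReal, fun h => ?_⟩
  rw [hc, integral_smul_measure, hm1, hemb.integral_map, smul_eq_mul]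

open scoped Pointwise in
theorem hausdorff_scale {n : ℕ} (hn : 2 ≤ n) (Q : E n) {r : ℝ} (hr : 0 < r) (g : E n → ℝ) :
    ∫ x in sphere Q r, g x ∂μH[(n : ℝ) - 1] =
      r ^ (n - 1) * ∫ w in sphere (0 : E n) 1, g (Q + r • w) ∂μH[(n : ℝ) - 1] := by
  have hd : (0 : ℝ) ≤ (n : ℝ) - 1 := by
    have : (2 : ℝ) ≤ n := by exact_mod_cast hn
    linarith
  let e : E n ≃ₜ E n := (Homeomorph.smulOfNeZero r hr.ne').trans (Homeomorph.addLeft Q)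
  have he : ∀ x, e x = Q + r • x := fun x => rfl
  have hmap : (μH[(n : ℝ) - 1] : Measure (E n)) =
      (ENNReal.ofReal (r ^ (n - 1))) • Measure.map e μH[(n : ℝ) - 1] := by
    ext s hs
    rw [Measure.smul_apply, e.measurableEmbedding.map_apply]
    have hs1 : s = (IsometryEquiv.addLeft Q) '' (r • (e ⁻¹' s)) := by
      ext y
      simp only [mem_image, Set.mem_smul_set, mem_preimage]
      constructor
      · intro hy
        refine ⟨y - Q, ⟨e.symm y, by simpa using hy, ?_⟩, by simp⟩
        have : e (e.symm y) = y := by simp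
        rw [he] at this
        rw [eq_sub_iff_add_eq, add_comm]
        exact this
      · rintro ⟨_, ⟨x, hx, rfl⟩, rfl⟩
        exact hx
    conv_lhs => rw [hs1, IsometryEquiv.hausdorffMeasure_image,
      Measure.hausdorffMeasure_smul₀ hd hr.ne']
    have hcoef : ((‖r‖₊ ^ ((n : ℝ) - 1) : ℝ≥0) : ℝ≥0∞) = ENNReal.ofReal (r ^ (n - 1)) := by
      rw [ENNReal.ofReal, ENNReal.coe_inj]
      ext
      rw [Real.coe_toNNReal _ (by positivity), NNReal.coe_rpow, coe_nnnorm, Real.norm_of_nonneg hr.le,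
        ← Real.rpow_natCast, Nat.cast_sub (by omega), Nat.cast_one]
    rw [← hcoef]
    rfl
  conv_lhs => rw [hmap]
  rw [Measure.restrict_smul, integral_smul_measure, e.measurableEmbedding.setIntegral_map,
    ENNReal.toReal_ofReal (by positivity), smul_eq_mul]
  congr 2
  congr 1
  ext x
  simp [he, norm_smul, abs_of_pos hr, hr.ne']

/-! ### Harmonic functions on a ball centred at the origin -/

def pd {n : ℕ} (f : E n → ℝ) (j : Fin n) (x : E n) : ℝ :=
  fderiv ℝ f x (EuclideanSpace.single j 1)

theorem norm_grad {n : ℕ} (f : E n → ℝ) (x : E n) : ‖gradient f x‖ ^ 2 = ∑ j, pd f j x ^ 2 := by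
  rw [EuclideanSpace.real_norm_sq_eq]
  refine Finset.sum_congr rfl fun j _ => ?_
  congr 1
  have h : ⟪gradient f x, EuclideanSpace.single j (1 : ℝ)⟫ = pd f j x := inner_gradient_left
  rw [← h, EuclideanSpace.inner_single_right]
  simp

theorem pd_c1 {n : ℕ} {R : ℝ} {f : E n → ℝ} (hf : ContDiffOn ℝ 2 f (ball 0 R)) (j : Fin n) :
    ContDiffOn ℝ 1 (pd f j) (ball 0 R) := by
  unfold pd
  exact (hf.fderiv_of_isOpen isOpen_ball (by norm_num)).clm_apply contDiffOn_const

theorem pd_symm {n : ℕ} {R : ℝ} {f : E n → ℝ} (hf : ContDiffOn ℝ 2 f (ball 0 R)) (i j : Fin n)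
    {x : E n} (hx : x ∈ ball (0 : E n) R) : pd (pd f j) i x = pd (pd f i) j x := by
  have hfx : ContDiffAt ℝ 2 f x := hf.contDiffAt (isOpen_ball.mem_nhds hx)
  have hd : DifferentiableAt ℝ (fderiv ℝ f) x :=
    (hfx.fderiv_right (m := 1) (by norm_num)).differentiableAt one_ne_zero
  have h1 : ∀ k l : Fin n, pd (pd f k) l x =
      fderiv ℝ (fderiv ℝ f) x (EuclideanSpace.single l 1) (EuclideanSpace.single k 1) := by
    intro k l
    unfold pd
    have := (hd.hasFDerivAt.clm_apply (hasFDerivAt_const (EuclideanSpace.single k (1 : ℝ)) x)).fderiv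
    rw [this]
    simp
  rw [h1, h1]
  exact (hfx.isSymmSndFDerivAt (by simp)).eq _ _

theorem pd_hasFDeriv {n : ℕ} {R : ℝ} {g : E n → ℝ} (hg : ContDiffOn ℝ 1 g (ball 0 R)) {x : E n}
    (hx : x ∈ ball (0 : E n) R) (j : Fin n) :
    HasDerivAt (fun t : ℝ => g (x + t • EuclideanSpace.single j (1 : ℝ))) (pd g j x) 0 := by
  have h1 : HasDerivAt (fun t : ℝ => x + t • EuclideanSpace.single j (1 : ℝ))
      (EuclideanSpace.single j (1 : ℝ)) 0 := by
    simpa using ((hasDerivAt_id (0 : ℝ)).smul_const (EuclideanSpace.single j (1 : ℝ))).const_add x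
  have h2 : HasFDerivAt g (fderiv ℝ g x) (x + (0 : ℝ) • EuclideanSpace.single j (1 : ℝ)) := by
    simpa using c1_diff hg hx
  exact h2.comp_hasDerivAt (0 : ℝ) h1

theorem coord_pd {n : ℕ} (x : E n) (i j : Fin n) :
    HasDerivAt (fun t : ℝ => (x + t • EuclideanSpace.single j (1 : ℝ)) i)
      (if i = j then 1 else 0) 0 := by
  simp only [PiLp.add_apply, PiLp.smul_apply, EuclideanSpace.single, PiLp.single_apply, smul_eq_mul]
  simpa using ((hasDerivAt_id (0 : ℝ)).mul_const (if i = j then (1 : ℝ) else 0)).const_add (x i)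

def X1 {n : ℕ} (f : E n → ℝ) (j : Fin n) (x : E n) : ℝ := f x * pd f j x

def X2 {n : ℕ} (f : E n → ℝ) (j : Fin n) (x : E n) : ℝ :=
  (∑ k, pd f k x ^ 2) * x j - 2 * (∑ k, x k * pd f k x) * pd f j x

theorem X1_c1 {n : ℕ} {R : ℝ} {f : E n → ℝ} (hf : ContDiffOn ℝ 2 f (ball 0 R)) (j : Fin n) :
    ContDiffOn ℝ 1 (X1 f j) (ball 0 R) :=
  (hf.of_le (by norm_num)).mul (pd_c1 hf j)

theorem X2_c1 {n : ℕ} {R : ℝ} {f : E n → ℝ} (hf : ContDiffOn ℝ 2 f (ball 0 R)) (j : Fin n) :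
    ContDiffOn ℝ 1 (X2 f j) (ball 0 R) := by
  unfold X2
  refine ContDiffOn.sub (ContDiffOn.mul ?_ (coord_contDiff j).contDiffOn) (ContDiffOn.mul
    (contDiffOn_const.mul ?_) (pd_c1 hf j))
  · exact ContDiffOn.sum fun k _ => (pd_c1 hf k).pow 2
  · exact ContDiffOn.sum fun k _ => (coord_contDiff k).contDiffOn.mul (pd_c1 hf k)

theorem dv_X1 {n : ℕ} {R : ℝ} {f : E n → ℝ} (hf : ContDiffOn ℝ 2 f (ball 0 R))
    {x : E n} (hx : x ∈ ball (0 : E n) R) (hl : lap n f x = 0) :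
    dv (X1 f) x = ∑ k, pd f k x ^ 2 := by
  have hl' : ∑ j, pd (pd f j) j x = 0 := hl
  have h1 : ∀ j, pd (X1 f j) j x = pd f j x ^ 2 + f x * pd (pd f j) j x := by
    intro j
    refine (pd_hasFDeriv (X1_c1 hf j) hx j).unique ?_
    have := (pd_hasFDeriv (hf.of_le (by norm_num)) hx j).mul (pd_hasFDeriv (pd_c1 hf j) hx j)
    refine this.congr_deriv ?_
    simp; ring
  calc dv (X1 f) x = ∑ j, pd (X1 f j) j x := rfl
    _ = _ := by
      simp only [h1, Finset.sum_add_distrib, ← Finset.mul_sum, hl']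
      simp

theorem dv_X2 {n : ℕ} {R : ℝ} {f : E n → ℝ} (hf : ContDiffOn ℝ 2 f (ball 0 R))
    {x : E n} (hx : x ∈ ball (0 : E n) R) (hl : lap n f x = 0) :
    dv (X2 f) x = ((n : ℝ) - 2) * ∑ k, pd f k x ^ 2 := by
  have hl' : ∑ j, pd (pd f j) j x = 0 := hl
  have h1 : ∀ j, pd (X2 f j) j x = 2 * (∑ k, x j * (pd f k x * pd (pd f k) j x))
      + (∑ k, pd f k x ^ 2) - 2 * pd f j x ^ 2 - 2 * (∑ k, x k * (pd f j x * pd (pd f k) j x))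
      - 2 * (∑ k, x k * pd f k x) * pd (pd f j) j x := by
    intro j
    refine (pd_hasFDeriv (X2_c1 hf j) hx j).unique ?_
    have hS := HasDerivAt.fun_sum (u := Finset.univ)
      fun k _ => (pd_hasFDeriv (pd_c1 hf k) hx j).fun_pow 2
    have hT := HasDerivAt.fun_sum (u := Finset.univ)
      fun k _ => (coord_pd x k j).fun_mul (pd_hasFDeriv (pd_c1 hf k) hx j)
    have := (hS.fun_mul (coord_pd x j j)).fun_sub ((hT.const_mul 2).fun_mul
      (pd_hasFDeriv (pd_c1 hf j) hx j))
    refine this.congr_deriv ?_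
    simp only [zero_smul, add_zero, if_true, mul_one, Finset.sum_add_distrib, ite_mul, one_mul,
      zero_mul, Finset.sum_ite_eq', Finset.mem_univ]
    have e1 : ∑ k, x j * (pd f k x * pd (pd f k) j x) =
      (∑ k, pd f k x * pd (pd f k) j x) * x j := by
      rw [Finset.sum_mul]; exact Finset.sum_congr rfl fun k _ => by ring
    have e2 : ∑ k, x k * (pd f j x * pd (pd f k) j x) =
      (∑ k, x k * pd (pd f k) j x) * pd f j x := by
      rw [Finset.sum_mul]; exact Finset.sum_congr rfl fun k _ => by ring
    have e3 : ∑ k, ((2 : ℕ) : ℝ) * pd f k x ^ (2 - 1) * pd (pd f k) j x =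
      2 * (∑ k, pd f k x * pd (pd f k) j x) := by
      rw [Finset.mul_sum]; exact Finset.sum_congr rfl fun k _ => by norm_num; ring
    rw [e1, e2, e3]
    ring
  have hsw : ∑ j, ∑ k, x k * (pd f j x * pd (pd f k) j x) =
      ∑ j, ∑ k, x j * (pd f k x * pd (pd f k) j x) := by
    rw [Finset.sum_comm]
    refine Finset.sum_congr rfl fun j _ => Finset.sum_congr rfl fun k _ => ?_
    rw [pd_symm hf k j hx]
  calc dv (X2 f) x = ∑ j, pd (X2 f j) j x := rfl
    _ = _ := by
      simp only [h1, Finset.sum_add_distrib, Finset.sum_sub_distrib, ← Finset.mul_sum, hl', hsw]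
      simp
      ring

theorem us_sq {n : ℕ} (w : US n) : ∑ j, (w : E n) j ^ 2 = 1 := by
  have : ‖(w : E n)‖ = 1 := by simp
  rw [← EuclideanSpace.real_norm_sq_eq, this, one_pow]

theorem core {n : ℕ} (hn : 2 ≤ n) {R : ℝ} {f : E n → ℝ}
    (hf : ContDiffOn ℝ 2 f (ball 0 R)) (hl : ∀ x ∈ ball (0 : E n) R, lap n f x = 0)
    (hH : ∀ r ∈ Ioo 0 R, 0 < ∫ w : US n, f (r • (w : E n)) ^ 2 ∂(sg n)) :
    MonotoneOn (fun r => r * (∫ x in ball (0 : E n) r, ‖gradient f x‖ ^ 2) /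
      (r ^ (n - 1) * ∫ w : US n, f (r • (w : E n)) ^ 2 ∂(sg n))) (Ioo 0 R) := by
  have hf1 : ContDiffOn ℝ 1 f (ball 0 R) := hf.of_le (by norm_num)
  have hsub : Ioo 0 R ⊆ Ioo (-R) R := fun x hx => ⟨by linarith [hx.1, hx.2], hx.2⟩
  set S : E n → ℝ := fun x => ∑ k, pd f k x ^ 2 with hS
  have hSc : ContinuousOn S (ball 0 R) :=
    continuousOn_finsetSum _ fun k _ => (pd_c1 hf k).continuousOn.pow 2
  set H : ℝ → ℝ := fun r => ∫ w : US n, f (r • (w : E n)) ^ 2 ∂(sg n) with hHdef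
  set D : ℝ → ℝ := fun r => ∫ x in ball (0 : E n) r, ‖gradient f x‖ ^ 2 with hD
  set K : ℝ → ℝ := fun r => ∫ w : US n, S (r • (w : E n)) ∂(sg n) with hK
  set q : ℝ → US n → ℝ := fun r w => fderiv ℝ f (r • (w : E n)) w with hq
  have hqe : ∀ r w, q r w = ∑ j, (w : E n) j * pd f j (r • (w : E n)) := fun r w => clm_expand _ _
  set I : ℝ → ℝ := fun r => ∫ w : US n, f (r • (w : E n)) * q r w ∂(sg n) with hI
  set P : ℝ → ℝ := fun r => ∫ w : US n, q r w ^ 2 ∂(sg n) with hP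
  have hqc : ∀ r ∈ Ioo (-R) R, Continuous (q r) := fun r hr =>
    slice_cont hr q ((comp_smul_cont (c1_fderiv_cont hf1)).clm_apply (by fun_prop))
  have hfc : ∀ r ∈ Ioo (-R) R, Continuous (fun w : US n => f (r • (w : E n))) := fun r hr =>
    slice_cont hr (fun r (w : US n) => f (r • (w : E n))) (comp_smul_cont hf1.continuousOn)
  have hScw : ∀ r ∈ Ioo (-R) R, Continuous (fun w : US n => S (r • (w : E n))) := fun r hr =>
    slice_cont hr (fun r (w : US n) => S (r • (w : E n))) (comp_smul_cont hSc)
  have hKc : ContinuousOn K (Ioo (-R) R) :=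
    param_cont (fun r (w : US n) => S (r • (w : E n))) (comp_smul_cont hSc)
  -- polar coordinates
  have hDp : ∀ r ∈ Ioo 0 R, D r = ∫ s in (0 : ℝ)..r, s ^ (n - 1) * K s := by
    intro r hr
    rw [hD]
    simp only [norm_grad]
    exact polar hn hr hSc
  -- D = r^{n-1} I
  have hDI : ∀ r ∈ Ioo 0 R, D r = r ^ (n - 1) * I r := by
    intro r hr
    have h := div_thm hn hr (X1_c1 hf)
    rw [hDp r hr]
    have e1 : ∫ s in (0 : ℝ)..r, s ^ (n - 1) * K s =
        ∫ s in (0 : ℝ)..r, s ^ (n - 1) * ∫ w : US n, dv (X1 f) (s • (w : E n)) ∂(sg n) := by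
      refine intervalIntegral.integral_congr fun s hs => ?_
      rw [uIcc_of_le hr.1.le] at hs
      have hs' : s ∈ Ioo (-R) R := ⟨by linarith [hs.1, hr.1, hr.2], by linarith [hs.2, hr.2]⟩
      simp only [hK]
      congr 1
      refine integral_congr_ae (.of_forall fun w => ?_)
      exact (dv_X1 hf (smul_mem_ball hs' w) (hl _ (smul_mem_ball hs' w))).symm
    rw [e1, h]
    congr 1
    refine integral_congr_ae (.of_forall fun w => ?_)
    simp only [hqe, X1, Finset.mul_sum]
    exact Finset.sum_congr rfl fun j _ => by ring
  -- Rellich / Pohozaev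
  have hPoh : ∀ r ∈ Ioo 0 R, ((n : ℝ) - 2) * D r = r ^ (n - 1) * (r * (K r - 2 * P r)) := by
    intro r hr
    have hr' := hsub hr
    have h := div_thm hn hr (X2_c1 hf)
    rw [hDp r hr]
    have e1 : ((n : ℝ) - 2) * ∫ s in (0 : ℝ)..r, s ^ (n - 1) * K s =
        ∫ s in (0 : ℝ)..r, s ^ (n - 1) * ∫ w : US n, dv (X2 f) (s • (w : E n)) ∂(sg n) := by
      rw [← intervalIntegral.integral_const_mul]
      refine intervalIntegral.integral_congr fun s hs => ?_
      rw [uIcc_of_le hr.1.le] at hs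
      have hs' : s ∈ Ioo (-R) R := ⟨by linarith [hs.1, hr.1, hr.2], by linarith [hs.2, hr.2]⟩
      simp only [hK]
      rw [mul_left_comm, ← integral_const_mul]
      congr 1
      refine integral_congr_ae (.of_forall fun w => ?_)
      exact (dv_X2 hf (smul_mem_ball hs' w) (hl _ (smul_mem_ball hs' w))).symm
    rw [e1, h]
    congr 1
    have e2 : ∀ w : US n, ∑ j, (w : E n) j * X2 f j (r • (w : E n)) =
        r * (S (r • (w : E n)) - 2 * q r w ^ 2) := by
      intro w
      have hqq : ∑ k, (r • (w : E n)) k * pd f k (r • (w : E n)) = r * q r w := by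
        rw [hqe, Finset.mul_sum]
        exact Finset.sum_congr rfl fun k _ => by simp; ring
      have h3 : ∀ j, (w : E n) j * X2 f j (r • (w : E n)) =
          r * S (r • (w : E n)) * (w : E n) j ^ 2
          - 2 * r * q r w * ((w : E n) j * pd f j (r • (w : E n))) := by
        intro j
        unfold X2
        rw [hqq]
        simp [hS]
        ring
      simp only [h3, Finset.sum_sub_distrib, ← Finset.mul_sum, us_sq, ← hqe]
      ring
    simp only [e2]
    have i2 : Integrable (fun w => 2 * q r w ^ 2) (sg n) :=
      (us_cont_int (g := fun w => q r w ^ 2) ((hqc r hr').pow 2)).const_mul 2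
    rw [integral_const_mul, integral_sub (us_cont_int (hScw r hr')) i2, integral_const_mul]
  -- derivatives
  have hHd : ∀ r ∈ Ioo 0 R, HasDerivAt H (2 * I r) r := by
    intro r hr
    have h := radial_deriv_fun (hsub hr) (hf1.pow 2)
    refine h.congr_deriv ?_
    rw [hI]
    simp only
    rw [← integral_const_mul]
    refine integral_congr_ae (.of_forall fun w => ?_)
    have hd := c1_diff hf1 (smul_mem_ball (hsub hr) w)
    have this := (hd.mul hd).fderiv
    have e0 : (fun x => f x ^ 2) = f * f := by
      funext x
      simp [sq]
    simp only [e0, this, hq]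
    simp
    ring
  have hDd : ∀ r ∈ Ioo 0 R, HasDerivAt D (r ^ (n - 1) * K r) r := by
    intro r hr
    have hr' := hsub hr
    have hc : ContinuousOn (fun s => s ^ (n - 1) * K s) (Ioo (-R) R) :=
      ContinuousOn.mul (by fun_prop) hKc
    have h : HasDerivAt (fun r => ∫ s in (0 : ℝ)..r, s ^ (n - 1) * K s) (r ^ (n - 1) * K r) r := by
      refine intervalIntegral.integral_hasDerivAt_right ?_ ?_ (hc.continuousAt (isOpen_Ioo.mem_nhds hr'))
      · apply ContinuousOn.intervalIntegrable
        rw [uIcc_of_le hr.1.le]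
        exact hc.mono fun s hs => ⟨by linarith [hs.1, hr.1, hr.2], by linarith [hs.2, hr.2]⟩
      · exact hc.stronglyMeasurableAtFilter isOpen_Ioo r hr'
    refine h.congr_of_eventuallyEq ?_
    filter_upwards [isOpen_Ioo.mem_nhds hr] with s hs using hDp s hs
  -- Cauchy-Schwarz
  have hCS : ∀ r ∈ Ioo 0 R, I r ^ 2 ≤ P r * H r := by
    intro r hr
    have hr' := hsub hr
    have hHr : 0 < H r := hH r hr
    have h0 : 0 ≤ ∫ w : US n, (H r * q r w - I r * f (r • (w : E n))) ^ 2 ∂(sg n) :=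
      integral_nonneg fun w => sq_nonneg _
    have e : ∀ w : US n, (H r * q r w - I r * f (r • (w : E n))) ^ 2 =
        H r ^ 2 * q r w ^ 2 - 2 * H r * I r * (f (r • (w : E n)) * q r w)
        + I r ^ 2 * f (r • (w : E n)) ^ 2 := fun w => by ring
    simp only [e] at h0
    have i1 : Integrable (fun w => H r ^ 2 * q r w ^ 2) (sg n) :=
      (us_cont_int (g := fun w => q r w ^ 2) ((hqc r hr').pow 2)).const_mul (H r ^ 2)
    have i2 : Integrable (fun w : US n => 2 * H r * I r * (f (r • (w : E n)) * q r w)) (sg n) :=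
      (us_cont_int (g := fun w : US n => f (r • (w : E n)) * q r w) ((hfc r hr').mul (hqc r hr'))).const_mul (2 * H r * I r)
    have i3 : Integrable (fun w : US n => I r ^ 2 * f (r • (w : E n)) ^ 2) (sg n) :=
      (us_cont_int (g := fun w : US n => f (r • (w : E n)) ^ 2) ((hfc r hr').pow 2)).const_mul (I r ^ 2)
    rw [integral_add (Integrable.sub' i1 i2) i3, integral_sub i1 i2] at h0
    simp only [integral_const_mul] at h0
    have h1 : 0 ≤ H r ^ 2 * P r - 2 * H r * I r * I r + I r ^ 2 * H r := h0
    have h2 : 0 ≤ H r * (P r * H r - I r ^ 2) := by nlinarith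
    have := nonneg_of_mul_nonneg_right h2 hHr
    linarith
  -- conclusion
  obtain ⟨m, rfl⟩ : ∃ m, n = m + 2 := ⟨n - 2, by omega⟩
  have en : m + 2 - 1 = m + 1 := by omega
  rw [en] at *
  have hfe : EqOn (fun r => D r / (r ^ m * H r)) (fun r => r * D r / (r ^ (m + 1) * H r))
      (Ioo 0 R) := by
    intro r hr
    have h1 := hr.1.ne'
    have h2 := (hH r hr).ne'
    simp only
    rw [pow_succ]
    field_simp
  refine MonotoneOn.congr ?_ hfe
  have hder : ∀ r ∈ Ioo 0 R, HasDerivAt (fun r => D r / (r ^ m * H r))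
      ((r ^ (m + 1) * K r * (r ^ m * H r) - D r * (m * r ^ (m - 1) * H r + r ^ m * (2 * I r))) /
        (r ^ m * H r) ^ 2) r := by
    intro r hr
    have hp : r ^ m * H r ≠ 0 := mul_ne_zero (pow_ne_zero _ hr.1.ne') (hH r hr).ne'
    exact (hDd r hr).fun_div ((hasDerivAt_pow m r).fun_mul (hHd r hr)) hp
  refine monotoneOn_of_deriv_nonneg (convex_Ioo 0 R)
    (fun r hr => (hder r hr).continuousAt.continuousWithinAt) ?_ ?_
  · rw [interior_Ioo]
    exact fun r hr => (hder r hr).differentiableAt.differentiableWithinAt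
  · rw [interior_Ioo]
    intro r hr
    rw [(hder r hr).deriv]
    refine div_nonneg ?_ (sq_nonneg _)
    refine nonneg_of_mul_nonneg_right (a := r) ?_ hr.1
    have hm : r * ((m : ℝ) * r ^ (m - 1)) = m * r ^ m := by
      rcases m with _ | m
      · simp
      · simp only [Nat.add_sub_cancel]; ring
    have h1 := hPoh r hr
    have h2 : D r = r ^ (m + 1) * I r := hDI r hr
    push_cast at h1
    have e : r * (r ^ (m + 1) * K r * (r ^ m * H r) -
        D r * (m * r ^ (m - 1) * H r + r ^ m * (2 * I r))) =
        2 * (r ^ (m + 1)) ^ 2 * (P r * H r - I r ^ 2) := by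
      have h1' : (m : ℝ) * D r = r ^ (m + 1) * (r * (K r - 2 * P r)) := by linarith
      linear_combination (-D r * H r) * hm - r ^ m * H r * h1' - 2 * r ^ (m + 1) * I r * h2
    rw [e]
    have := hCS r hr
    exact mul_nonneg (by positivity) (by linarith)

theorem transl_fderiv {n : ℕ} (Q : E n) (f : E n → ℝ) (x : E n) :
    fderiv ℝ (fun y => f (Q + y)) x = fderiv ℝ f (Q + x) := by
  rw [fderiv_comp_add_left]

theorem transl_lap {n : ℕ} (Q : E n) (f : E n → ℝ) (x : E n) :
    lap n (fun y => f (Q + y)) x = lap n f (Q + x) := by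
  unfold lap
  refine Finset.sum_congr rfl fun i _ => ?_
  simp only [transl_fderiv]
  rw [transl_fderiv Q (fun y => fderiv ℝ f y (EuclideanSpace.single i 1))]

theorem transl_grad {n : ℕ} (Q : E n) (f : E n → ℝ) (x : E n) :
    gradient (fun y => f (Q + y)) x = gradient f (Q + x) := by
  unfold gradient
  rw [transl_fderiv]

theorem transl_ball {n : ℕ} (Q : E n) (g : E n → ℝ) (r : ℝ) :
    ∫ x in ball Q r, g x = ∫ x in ball (0 : E n) r, g (Q + x) := by
  have h := (measurePreserving_add_left (volume : Measure (E n)) Q).setIntegral_preimage_emb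
    (MeasurableEquiv.addLeft Q).measurableEmbedding g (ball Q r)
  have hp : (fun x => Q + x) ⁻¹' ball Q r = ball (0 : E n) r := by
    ext x
    simp
  rw [← h, hp]

/-- Almgren's frequency `N(r) = r D(r)/H(r)` of a harmonic function is nondecreasing. -/
theorem stmt_11 (n : ℕ) (hn : 2 ≤ n) (Q : E n) (R : ℝ) (hR : 0 < R)
    (f : E n → ℝ) (hf : ContDiffOn ℝ 2 f (ball Q R))
    (hharm : ∀ x ∈ ball Q R, lap n f x = 0)
    (hH : ∀ r : ℝ, 0 < r → r < R → 0 < ∫ x in sphere Q r, (f x) ^ 2 ∂μH[(n : ℝ) - 1]) :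
    MonotoneOn (fun r => r * (∫ x in ball Q r, ‖gradient f x‖ ^ 2) /
      ∫ x in sphere Q r, (f x) ^ 2 ∂μH[(n : ℝ) - 1]) (Set.Ioo 0 R) := by
  set f0 : E n → ℝ := fun y => f (Q + y) with hf0
  have hf0c : ContDiffOn ℝ 2 f0 (ball 0 R) := by
    refine hf.comp (contDiff_const.add contDiff_id).contDiffOn fun x hx => ?_
    simpa using hx
  have hl0 : ∀ x ∈ ball (0 : E n) R, lap n f0 x = 0 := by
    intro x hx
    rw [hf0, transl_lap]
    exact hharm _ (by simpa using hx)
  have hR2 : 0 < R / 2 := by linarith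
  have hgc : ContinuousOn (fun w : E n => f (Q + (R / 2) • w) ^ 2) (sphere 0 1) := by
    refine ContinuousOn.pow (hf.continuousOn.comp (by fun_prop) fun w hw => ?_) 2
    have hw1 : ‖w‖ = 1 := by simpa using hw
    simp only [mem_ball, dist_self_add_left, norm_smul, hw1, Real.norm_eq_abs, abs_of_pos hR2]
    linarith
  have hg0 : ∫ w in sphere (0 : E n) 1, f (Q + (R / 2) • w) ^ 2 ∂μH[(n : ℝ) - 1] ≠ 0 := by
    intro h0
    have h1 := hH (R / 2) hR2 (by linarith)
    rw [hausdorff_scale hn Q hR2, h0] at h1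
    simp at h1
  obtain ⟨c, hc⟩ := hausdorff_sphere hn hgc hg0
  have hs : ∀ r, 0 < r → ∫ x in sphere Q r, (f x) ^ 2 ∂μH[(n : ℝ) - 1] =
      r ^ (n - 1) * (c * ∫ w : US n, f0 (r • (w : E n)) ^ 2 ∂(sg n)) := by
    intro r hr
    rw [hausdorff_scale hn Q hr, hc]
  have hnn : ∀ r : ℝ, 0 ≤ ∫ w : US n, f0 (r • (w : E n)) ^ 2 ∂(sg n) := fun r =>
    integral_nonneg fun w => sq_nonneg _
  have hpos : ∀ r ∈ Ioo 0 R, 0 < c * ∫ w : US n, f0 (r • (w : E n)) ^ 2 ∂(sg n) := by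
    intro r hr
    have h1 := hH r hr.1 hr.2
    rw [hs r hr.1] at h1
    exact pos_of_mul_pos_right h1 (pow_nonneg hr.1.le _)
  have hc0 : 0 < c := pos_of_mul_pos_left (hpos (R / 2) ⟨hR2, by linarith⟩) (hnn _)
  have hH0 : ∀ r ∈ Ioo 0 R, 0 < ∫ w : US n, f0 (r • (w : E n)) ^ 2 ∂(sg n) := fun r hr =>
    pos_of_mul_pos_right (hpos r hr) hc0.le
  have hcore := core hn hf0c hl0 hH0
  have key : ∀ r ∈ Ioo 0 R, r * (∫ x in ball Q r, ‖gradient f x‖ ^ 2) /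
      ∫ x in sphere Q r, (f x) ^ 2 ∂μH[(n : ℝ) - 1] =
      c⁻¹ * (r * (∫ x in ball (0 : E n) r, ‖gradient f0 x‖ ^ 2) /
      (r ^ (n - 1) * ∫ w : US n, f0 (r • (w : E n)) ^ 2 ∂(sg n))) := by
    intro r hr
    rw [hs r hr.1, transl_ball]
    simp only [hf0, transl_grad]
    rw [mul_left_comm, div_mul_eq_div_div_swap, div_eq_inv_mul _ c, mul_div_assoc]
  intro a ha b hb hab
  simp only
  rw [key a ha, key b hb]
  exact mul_le_mul_of_nonneg_left (hcore ha hb hab) (inv_nonneg.mpr hc0.le)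
end
end

section
/- Let d ∈ ℕ, β ∈ (0,1), K ⊂ ℝⁿ compact, and for each Q ∈ K let p^{(Q)} : ℝⁿ → ℝ be a polynomial of degree ≤ d. Suppose there exists C > 0 such that the harmonic-function difference H(x) = p^{(Q₁)}(x - Q₁) - p^{(Q₂)}(x - Q₂) satisfies sup_{B(Q₁, 4|Q₁-Q₂|)} |H| ≤ C |Q₁ - Q₂|^{β+d} for all Q₁, Q₂ ∈ K with |Q₁ - Q₂| < 1/1000, each p^{(Q)} is a harmonic polynomial, and sup_{Q∈K} ‖p^{(Q)}‖_{L^∞(B(0,1))} ≤ C. Then for every multi-index χ with |χ| ≤ d there exists C' > 0 such that |D^χ H(Q₁)| ≤ C' |Q₁ - Q₂|^{β + d - |χ|} for all Q₁, Q₂ ∈ K. -/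
open MeasureTheory Metric Filter Set
open scoped ENNReal NNReal Topology RealInnerProductSpace

noncomputable section

def evE {n : ℕ} (P : MvPolynomial (Fin n) ℝ) (x : E n) : ℝ := MvPolynomial.eval (fun i => x i) P

lemma evE_contDiff {n : ℕ} (P : MvPolynomial (Fin n) ℝ) {m : WithTop ℕ∞} : ContDiff ℝ m (evE P) := by
  induction P using MvPolynomial.induction_on with
  | C a =>
    have : evE (MvPolynomial.C a) = fun _ : E n => a := by ext x; simp [evE]
    rw [this]; exact contDiff_const
  | add p q hp hq =>
    have : evE (p + q) = fun x : E n => evE p x + evE q x := by ext x; simp [evE]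
    rw [this]; exact hp.add hq
  | mul_X p i hp =>
    have : evE (p * MvPolynomial.X i) = fun x : E n => evE p x * x i := by ext x; simp [evE]
    rw [this]
    exact hp.mul (EuclideanSpace.proj (𝕜 := ℝ) i).contDiff

lemma evE_affine {n : ℕ} (P : MvPolynomial (Fin n) ℝ) (Q : E n) (r : ℝ) :
    ∃ P' : MvPolynomial (Fin n) ℝ, P'.totalDegree ≤ P.totalDegree ∧
      ∀ y, evE P' y = evE P (Q + r • y) := by
  let g : Fin n → MvPolynomial (Fin n) ℝ := fun i =>
    MvPolynomial.C (Q i) + MvPolynomial.C r * MvPolynomial.X i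
  have hg : ∀ i, (g i).totalDegree ≤ 1 := by
    intro i
    refine (MvPolynomial.totalDegree_add _ _).trans (max_le (by simp) ?_)
    refine (MvPolynomial.totalDegree_mul _ _).trans ?_
    simp
  refine ⟨MvPolynomial.aeval g P, ?_, ?_⟩
  · rw [MvPolynomial.aeval_def, MvPolynomial.eval₂_eq']
    refine MvPolynomial.totalDegree_finsetSum_le fun s hs => ?_
    refine (MvPolynomial.totalDegree_mul _ _).trans ?_
    refine le_trans ?_ (MvPolynomial.le_totalDegree hs)
    have h1 : (algebraMap ℝ (MvPolynomial (Fin n) ℝ) (P.coeff s)).totalDegree = 0 :=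
      MvPolynomial.totalDegree_C _
    rw [h1, zero_add, Finsupp.sum_fintype _ _ (by simp)]
    refine (MvPolynomial.totalDegree_finsetProd _ _).trans (Finset.sum_le_sum fun i _ => ?_)
    refine (MvPolynomial.totalDegree_pow _ _).trans ?_
    simpa using Nat.mul_le_mul_left (s i) (hg i)
  · intro y
    unfold evE
    rw [← MvPolynomial.coe_aeval_eq_eval, ← MvPolynomial.coe_aeval_eq_eval]
    change ((MvPolynomial.aeval fun i => y i).comp (MvPolynomial.aeval g)) P = MvPolynomial.aeval _ P
    rw [MvPolynomial.comp_aeval]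
    congr 2
    ext i
    simp [g]

lemma evE_inj {n : ℕ} (P : MvPolynomial (Fin n) ℝ)
    (h : ∀ x ∈ closedBall (0 : E n) 1, evE P x = 0) : P = 0 := by
  refine MvPolynomial.funext_set (fun _ => Set.Icc (0:ℝ) (1 / (n + 1)))
    (fun _ => Set.Icc_infinite (by positivity)) fun x hx => ?_
  rw [map_zero]
  refine h (WithLp.toLp 2 x) ?_
  rw [mem_closedBall_zero_iff, EuclideanSpace.norm_eq, Real.sqrt_le_one]
  have hpos : (0:ℝ) < n + 1 := by positivity
  calc ∑ i, ‖x i‖ ^ 2 ≤ ∑ i : Fin n, (1 / ((n:ℝ) + 1)) := by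
        refine Finset.sum_le_sum fun i _ => ?_
        have hi := hx i (mem_univ i)
        have h1 : 1 / ((n:ℝ) + 1) ≤ 1 := by
          rw [div_le_one hpos]; linarith [(Nat.cast_nonneg n : (0:ℝ) ≤ n)]
        rw [Real.norm_eq_abs, sq_abs]
        nlinarith [hi.1, hi.2]
    _ ≤ 1 := by
        rw [Finset.sum_const, Finset.card_univ, Fintype.card_fin, nsmul_eq_mul, mul_one_div,
          div_le_one hpos]
        linarith

lemma absBound {V F G : Type*} [AddCommGroup V] [Module ℝ V] [FiniteDimensional ℝ V]
    [NormedAddCommGroup F] [NormedSpace ℝ F] [NormedAddCommGroup G] [NormedSpace ℝ G]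
    (T : V →ₗ[ℝ] F) (hT : Function.Injective T) (L : V →ₗ[ℝ] G) :
    ∃ M : ℝ, 0 ≤ M ∧ ∀ v, ‖L v‖ ≤ M * ‖T v‖ := by
  let e : V ≃ₗ[ℝ] LinearMap.range T := LinearEquiv.ofInjective T hT
  let S : LinearMap.range T →L[ℝ] G := LinearMap.toContinuousLinearMap (L ∘ₗ e.symm.toLinearMap)
  refine ⟨‖S‖, S.opNorm_nonneg, fun v => ?_⟩
  have h1 : S (e v) = L v := by simp [S]
  rw [← h1]
  exact S.le_opNorm (e v)

lemma key {n : ℕ} (d : ℕ) {G : Type*} [NormedAddCommGroup G] [NormedSpace ℝ G]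
    (L : MvPolynomial (Fin n) ℝ →ₗ[ℝ] G) :
    ∃ M : ℝ, 0 ≤ M ∧ ∀ P : MvPolynomial (Fin n) ℝ, P.totalDegree ≤ d → ∀ A : ℝ, 0 ≤ A →
      (∀ x ∈ closedBall (0 : E n) 1, |evE P x| ≤ A) → ‖L P‖ ≤ M * A := by
  have : CompactSpace (closedBall (0 : E n) 1) :=
    isCompact_iff_compactSpace.mp (isCompact_closedBall _ _)
  let T : MvPolynomial.restrictTotalDegree (Fin n) ℝ d →ₗ[ℝ]
      BoundedContinuousFunction (closedBall (0 : E n) 1) ℝ :=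
    { toFun := fun P => BoundedContinuousFunction.mkOfCompact ⟨fun x => evE P.1 x.1,
        (evE_contDiff (m := 0) P.1).continuous.comp continuous_subtype_val⟩
      map_add' := by intro P Q; ext x; simp [evE]
      map_smul' := by intro c P; ext x; simp [evE] }
  have hT : Function.Injective T := by
    rw [← LinearMap.ker_eq_bot, LinearMap.ker_eq_bot']
    intro P hP
    apply Subtype.ext
    exact evE_inj P.1 fun x hx => DFunLike.congr_fun hP ⟨x, hx⟩
  obtain ⟨M, hM, h0⟩ := absBound T hT
    (L ∘ₗ (MvPolynomial.restrictTotalDegree (Fin n) ℝ d).subtype)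
  refine ⟨M, hM, fun P hP A hA h => ?_⟩
  let P' : MvPolynomial.restrictTotalDegree (Fin n) ℝ d :=
    ⟨P, (MvPolynomial.mem_restrictTotalDegree _ _ _).2 hP⟩
  refine (h0 P').trans (mul_le_mul_of_nonneg_left ?_ hM)
  rw [BoundedContinuousFunction.norm_le hA]
  intro x
  exact h x.1 x.2

lemma key_deriv (n d k : ℕ) : ∃ M : ℝ, 0 ≤ M ∧ ∀ P : MvPolynomial (Fin n) ℝ,
    P.totalDegree ≤ d → ∀ A : ℝ, 0 ≤ A → ∀ (Q : E n) (r : ℝ), 0 ≤ r →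
      (∀ x ∈ closedBall Q r, |evE P x| ≤ A) →
      r ^ k * ‖iteratedFDeriv ℝ k (evE P) Q‖ ≤ M * A := by
  let L : MvPolynomial (Fin n) ℝ →ₗ[ℝ] (E n) [×k]→L[ℝ] ℝ :=
    { toFun := fun P => iteratedFDeriv ℝ k (evE P) 0
      map_add' := by
        intro P Q
        have : evE (P + Q) = evE P + evE Q := by ext x; simp [evE]
        rw [this, iteratedFDeriv_add_apply (evE_contDiff P).contDiffAt (evE_contDiff Q).contDiffAt]
      map_smul' := by
        intro c P
        have : evE (c • P) = c • evE P := by ext x; simp [evE]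
        rw [this, iteratedFDeriv_const_smul_apply (evE_contDiff P).contDiffAt]
        rfl }
  obtain ⟨M, hM, h⟩ := key d L
  refine ⟨M, hM, fun P hP A hA Q r hr hb => ?_⟩
  obtain ⟨P', hP', hev⟩ := evE_affine P Q r
  have h2 := h P' (hP'.trans hP) A hA (by
    intro x hx
    rw [hev]
    apply hb
    rw [mem_closedBall_zero_iff] at hx
    rw [mem_closedBall, dist_eq_norm, add_sub_cancel_left, norm_smul, Real.norm_of_nonneg hr]
    nlinarith)
  have h3 : L P' = r ^ k • iteratedFDeriv ℝ k (evE P) Q := by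
    change iteratedFDeriv ℝ k (evE P') 0 = _
    have h4 : evE P' = fun y => (fun z => evE P (Q + z)) (r • y) := by ext y; exact hev y
    have h5 : ContDiff ℝ k (fun z => evE P (Q + z)) :=
      (evE_contDiff P).comp (contDiff_const.add contDiff_id)
    rw [h4, iteratedFDeriv_comp_const_smul r h5]
    simp only [smul_zero]
    rw [iteratedFDeriv_comp_add_left, add_zero]
  rw [h3, norm_smul, norm_pow, Real.norm_of_nonneg hr] at h2
  exact h2

lemma key_far (n d : ℕ) (R : ℝ) : ∃ M : ℝ, 0 ≤ M ∧ ∀ P : MvPolynomial (Fin n) ℝ,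
    P.totalDegree ≤ d → ∀ A : ℝ, 0 ≤ A →
      (∀ x ∈ closedBall (0 : E n) 1, |evE P x| ≤ A) →
      ∀ x ∈ closedBall (0 : E n) R, |evE P x| ≤ M * A := by
  have : CompactSpace (closedBall (0 : E n) R) :=
    isCompact_iff_compactSpace.mp (isCompact_closedBall _ _)
  let T : MvPolynomial (Fin n) ℝ →ₗ[ℝ] C(closedBall (0 : E n) R, ℝ) :=
    { toFun := fun P => ⟨fun x => evE P x.1,
        (evE_contDiff (m := 0) P).continuous.comp continuous_subtype_val⟩
      map_add' := by intro P Q; ext x; simp [evE]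
      map_smul' := by intro c P; ext x; simp [evE] }
  obtain ⟨M, hM, h⟩ := key d T
  refine ⟨M, hM, fun P hP A hA hb x hx => ?_⟩
  exact ((T P).norm_coe_le_norm ⟨x, hx⟩).trans (h P hP A hA hb)

/-- Verification of the Whitney extension hypotheses (Lemma 7.5): a uniform `L^∞` bound
on the polynomials and a Hölder-type closeness bound for nearby base points yield bounds
on all derivatives of order `k ≤ d` of the difference
`H(x) = p^{(Q₁)}(x-Q₁) - p^{(Q₂)}(x-Q₂)` at `Q₁`. -/
theorem stmt_17 (n : ℕ) (hn : 2 ≤ n) (d : ℕ) (β : ℝ) (hβ : β ∈ Set.Ioo (0 : ℝ) 1)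
    (K : Set (E n)) (hK : IsCompact K)
    (p : E n → E n → ℝ) (C : ℝ) (hC : 0 < C)
    (hpoly : ∀ Q ∈ K, ∃ P : MvPolynomial (Fin n) ℝ,
      P.totalDegree ≤ d ∧ ∀ x : E n, p Q x = MvPolynomial.eval (fun i => x i) P)
    (hharm : ∀ Q ∈ K, ∀ x, lap n (p Q) x = 0)
    (hbound : ∀ Q ∈ K, ∀ x ∈ closedBall (0 : E n) 1, |p Q x| ≤ C)
    (hgrowth : ∀ Q₁ ∈ K, ∀ Q₂ ∈ K, dist Q₁ Q₂ < 1 / 1000 →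
      ∀ x ∈ closedBall Q₁ (4 * dist Q₁ Q₂),
        |p Q₁ (x - Q₁) - p Q₂ (x - Q₂)| ≤ C * dist Q₁ Q₂ ^ (β + d)) :
    ∀ k : ℕ, k ≤ d → ∃ C' > 0, ∀ Q₁ ∈ K, ∀ Q₂ ∈ K,
      ‖iteratedFDeriv ℝ k (fun x => p Q₁ (x - Q₁) - p Q₂ (x - Q₂)) Q₁‖ ≤
        C' * dist Q₁ Q₂ ^ (β + d - k) := by
  intro k hk
  obtain ⟨M, hM, hder⟩ := key_deriv n d k
  obtain ⟨D, hD⟩ := (Metric.isBounded_iff (s := K)).1 hK.isBounded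
  obtain ⟨M', hM', hfar⟩ := key_far n d (D + 1)
  have hkd : (k : ℝ) ≤ d := by exact_mod_cast hk
  have he : 0 < β + d - k := by linarith [hβ.1]
  set δ : ℝ := (1 / 1000 : ℝ) ^ (β + d - k) with hδ
  have hδ0 : 0 < δ := by positivity
  refine ⟨M * C + M * (C + M' * C) / δ + 1, by positivity, fun Q₁ h₁ Q₂ h₂ => ?_⟩
  have hX : 0 ≤ dist Q₁ Q₂ ^ (β + d - k) := by positivity
  obtain ⟨P₁, hd₁, he₁⟩ := hpoly Q₁ h₁
  obtain ⟨P₂, hd₂, he₂⟩ := hpoly Q₂ h₂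
  obtain ⟨R₁, hR₁, hv₁⟩ := evE_affine P₁ (-Q₁) 1
  obtain ⟨R₂, hR₂, hv₂⟩ := evE_affine P₂ (-Q₂) 1
  have hH : (fun x => p Q₁ (x - Q₁) - p Q₂ (x - Q₂)) = evE (R₁ - R₂) := by
    ext x
    have h3 : evE (R₁ - R₂) x = evE R₁ x - evE R₂ x := by simp [evE]
    rw [h3, hv₁, hv₂, he₁, he₂, one_smul, neg_add_eq_sub, neg_add_eq_sub]
    rfl
  have hdeg : (R₁ - R₂).totalDegree ≤ d :=
    (MvPolynomial.totalDegree_sub _ _).trans (max_le (hR₁.trans hd₁) (hR₂.trans hd₂))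
  have hval : ∀ x, evE (R₁ - R₂) x = p Q₁ (x - Q₁) - p Q₂ (x - Q₂) := fun x =>
    (congrFun hH x).symm
  rcases eq_or_ne Q₁ Q₂ with heq | hne
  · subst heq
    simp only [sub_self]
    have : iteratedFDeriv ℝ k (fun _ : E n => (0 : ℝ)) Q₁ = 0 := by
      simp
    rw [this, norm_zero]
    positivity
  rw [hH]
  have hρ : 0 < dist Q₁ Q₂ := dist_pos.2 hne
  rcases lt_or_ge (dist Q₁ Q₂) (1 / 1000) with hlt | hge
  · have h4 := hder _ hdeg (C * dist Q₁ Q₂ ^ (β + d)) (by positivity) Q₁ (dist Q₁ Q₂) hρ.le (by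
      intro x hx
      rw [hval]
      exact hgrowth Q₁ h₁ Q₂ h₂ hlt x (closedBall_subset_closedBall (by linarith) hx))
    have h5 : dist Q₁ Q₂ ^ (β + d) = dist Q₁ Q₂ ^ k * dist Q₁ Q₂ ^ (β + d - k) := by
      rw [← Real.rpow_natCast, ← Real.rpow_add hρ]; congr 1; ring
    have h6 : ‖iteratedFDeriv ℝ k (evE (R₁ - R₂)) Q₁‖ ≤ M * C * dist Q₁ Q₂ ^ (β + d - k) := by
      refine le_of_mul_le_mul_left ?_ (pow_pos hρ k)
      rw [h5] at h4
      linarith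
    refine h6.trans (mul_le_mul_of_nonneg_right ?_ hX)
    have : 0 ≤ M * (C + M' * C) / δ := by positivity
    linarith
  · have h4 := hder _ hdeg (C + M' * C) (by positivity) Q₁ 1 zero_le_one (by
      intro x hx
      rw [hval]
      rw [mem_closedBall, dist_eq_norm] at hx
      refine (abs_sub _ _).trans (add_le_add ?_ ?_)
      · exact hbound Q₁ h₁ _ (by rwa [mem_closedBall_zero_iff])
      · rw [he₂]
        refine hfar P₂ hd₂ C hC.le (fun y hy => ?_) _ ?_
        · have := hbound Q₂ h₂ y hy
          rwa [he₂] at this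
        · rw [mem_closedBall_zero_iff]
          have h7 := hD h₁ h₂
          rw [dist_eq_norm] at h7
          have h8 : x - Q₂ = (x - Q₁) + (Q₁ - Q₂) := by abel
          rw [h8]
          linarith [norm_add_le (x - Q₁) (Q₁ - Q₂)])
    rw [one_pow, one_mul] at h4
    have h9 : δ ≤ dist Q₁ Q₂ ^ (β + d - k) := Real.rpow_le_rpow (by norm_num) hge he.le
    calc _ ≤ M * (C + M' * C) := h4
      _ = M * (C + M' * C) / δ * δ := by field_simp
      _ ≤ M * (C + M' * C) / δ * dist Q₁ Q₂ ^ (β + d - k) :=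
        mul_le_mul_of_nonneg_left h9 (by positivity)
      _ ≤ _ := by
        refine mul_le_mul_of_nonneg_right ?_ hX
        have : 0 ≤ M * C := by positivity
        linarith
end
end
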